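/- An oracle A ⊆ ℕ is not low for weak 1-genericity (i.e., some A-effectively meager subset of Cantor space is contained in no effectively meager set) if and only if A is weakly meager engulfing or A is of hyperimmune degree. -/

import Mathlib

open Filter

namespace CichonAnalog

/-! ### Oracle computability -/

/-- Partial functions `ℕ →. ℕ` partial recursive relative to the oracle `A ⊆ ℕ`.
This is Mathlib's `Nat.Partrec` with an extra base case for the characteristic
function of the oracle. -/
inductive RecursiveIn (A : Set ℕ) : (ℕ →. ℕ) → Prop
  | zero : RecursiveIn A (pure 0)
  | succ : RecursiveIn A ↑Nat.succ
  | left : RecursiveIn A ↑fun n : ℕ => n.unpair.1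
  | right : RecursiveIn A ↑fun n : ℕ => n.unpair.2
  | oracle : RecursiveIn A ↑fun n : ℕ => A.indicator (fun _ => 1) n
  | pair {f g} : RecursiveIn A f → RecursiveIn A g →
      RecursiveIn A fun n => Nat.pair <$> f n <*> g n
  | comp {f g} : RecursiveIn A f → RecursiveIn A g →
      RecursiveIn A fun n => g n >>= f
  | prec {f g} : RecursiveIn A f → RecursiveIn A g →
      RecursiveIn A (Nat.unpaired fun a n =>
        n.rec (f a) fun y IH => do let i ← IH; g (Nat.pair a (Nat.pair y i)))
  | rfind {f} : RecursiveIn A f →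
      RecursiveIn A fun a => Nat.rfind fun n => (fun m => m = 0) <$> f (Nat.pair a n)

/-- The partial function `f` (between coded spaces) is partial recursive in the oracle `A`. -/
def PartrecIn (A : Set ℕ) {α σ : Type} [Primcodable α] [Primcodable σ] (f : α →. σ) : Prop :=
  RecursiveIn A fun n =>
    Part.bind ↑(Encodable.decode (α := α) n) fun a => (f a).map Encodable.encode

/-- `f ≤_T A` : the (total) function `f` is computable from the oracle `A`. -/
def ComputableIn (A : Set ℕ) {α σ : Type} [Primcodable α] [Primcodable σ] (f : α → σ) : Prop :=
  PartrecIn A (f : α →. σ)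

/-- `W` is computably enumerable in the oracle `A`. -/
def CEIn (A : Set ℕ) {α : Type} [Primcodable α] (W : Set α) : Prop :=
  ∃ f : α →. ℕ, PartrecIn A f ∧ ∀ a, a ∈ W ↔ (f a).Dom

/-- `W` is computably enumerable (unrelativized). -/
def CE {α : Type} [Primcodable α] (W : Set α) : Prop :=
  ∃ f : α →. ℕ, Partrec f ∧ ∀ a, a ∈ W ↔ (f a).Dom

/-! ### Cantor space, `Π⁰₁` classes, effective meagerness -/

/-- The basic clopen set (cylinder) of the finite binary string `σ` in Cantor space. -/
def Cyl (σ : List Bool) : Set (ℕ → Bool) :=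
  {x | ∀ i, i < σ.length → x i = σ.getD i false}

/-- `P` is a `Π⁰₁(A)` class: a closed subset of Cantor space whose complement is the
union of basic clopen sets over a set of strings c.e. in `A`. -/
def Pi01In (A : Set ℕ) (P : Set (ℕ → Bool)) : Prop :=
  ∃ W : Set (List Bool), CEIn A W ∧ P = (⋃ σ ∈ W, Cyl σ)ᶜ

/-- `P` is a (plain) `Π⁰₁` class. -/
def Pi01 (P : Set (ℕ → Bool)) : Prop :=
  ∃ W : Set (List Bool), CE W ∧ P = (⋃ σ ∈ W, Cyl σ)ᶜ

/-- `C` is a uniformly `Π⁰₁(A)` sequence of classes. -/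
def UnifPi01In (A : Set ℕ) (C : ℕ → Set (ℕ → Bool)) : Prop :=
  ∃ W : Set (ℕ × List Bool), CEIn A W ∧
    ∀ m, C m = (⋃ σ ∈ {s | (m, s) ∈ W}, Cyl σ)ᶜ

/-- `C` is a uniformly `Π⁰₁` sequence of classes. -/
def UnifPi01 (C : ℕ → Set (ℕ → Bool)) : Prop :=
  ∃ W : Set (ℕ × List Bool), CE W ∧
    ∀ m, C m = (⋃ σ ∈ {s | (m, s) ∈ W}, Cyl σ)ᶜ

/-- `S` is effectively meager relative to `A`: it is contained in the union of a
uniformly `Π⁰₁(A)` sequence of nowhere dense classes. -/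
def EffMeagerIn (A : Set ℕ) (S : Set (ℕ → Bool)) : Prop :=
  ∃ C : ℕ → Set (ℕ → Bool), UnifPi01In A C ∧ (∀ m, IsNowhereDense (C m)) ∧ S ⊆ ⋃ m, C m

/-- `S` is effectively meager (unrelativized). -/
def EffMeager (S : Set (ℕ → Bool)) : Prop :=
  ∃ C : ℕ → Set (ℕ → Bool), UnifPi01 C ∧ (∀ m, IsNowhereDense (C m)) ∧ S ⊆ ⋃ m, C m

/-- `A` is meager engulfing: some `A`-effectively meager set contains every
effectively meager set. -/
def MeagerEngulfing (A : Set ℕ) : Prop :=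
  ∃ S, EffMeagerIn A S ∧ ∀ T, EffMeager T → T ⊆ S

/-- `A` is weakly meager engulfing: some `A`-effectively meager set contains every
computable element of Cantor space. -/
def WeaklyMeagerEngulfing (A : Set ℕ) : Prop :=
  ∃ S, EffMeagerIn A S ∧ ∀ x : ℕ → Bool, Computable x → x ∈ S

/-- `V` is a computable set of finite binary strings. -/
def ComputableStringSet (V : Set (List Bool)) : Prop :=
  ∃ χ : List Bool → Bool, Computable χ ∧ ∀ s, s ∈ V ↔ χ s = true

/-- `V` is a dense set of finite binary strings: every string has an extension in `V`. -/
def DenseStringSet (V : Set (List Bool)) : Prop :=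
  ∀ σ : List Bool, ∃ τ ∈ V, σ <+: τ

/-- `x ∈ 2^ω` is weakly 1-generic: for every computable dense set `V` of finite
binary strings, some initial segment of `x` lies in `V`. -/
def Weakly1Generic (x : ℕ → Bool) : Prop :=
  ∀ V : Set (List Bool), ComputableStringSet V → DenseStringSet V →
    ∃ n, (List.ofFn fun i : Fin n => x i) ∈ V

/-! ### Domination properties -/

/-- `A` is high: `A` computes a function dominating every total computable function. -/
def High (A : Set ℕ) : Prop :=
  ∃ f : ℕ → ℕ, ComputableIn A f ∧
    ∀ g : ℕ → ℕ, Computable g → ∀ᶠ n in atTop, g n ≤ f n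

/-- `A` is of hyperimmune degree: `A` computes a function not dominated by any
computable function. -/
def HyperimmuneDegree (A : Set ℕ) : Prop :=
  ∃ f : ℕ → ℕ, ComputableIn A f ∧
    ∀ g : ℕ → ℕ, Computable g → ∃ᶠ n in atTop, g n < f n

/-- `A` is of hyperimmune-free degree: every function computable in `A` is dominated
by a total computable function. -/
def HyperimmuneFree (A : Set ℕ) : Prop :=
  ∀ f : ℕ → ℕ, ComputableIn A f →
    ∃ g : ℕ → ℕ, Computable g ∧ ∀ᶠ n in atTop, f n ≤ g n

/-! ### Measure on Cantor space, Kurtz and Schnorr tests -/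

open scoped Classical in
/-- The uniform measure of the clopen set `⋃ σ ∈ F, [σ]` determined by the finite
list `F` of binary strings: count the binary strings of maximal length extending
some member of `F`, and normalize. -/
noncomputable def listMeasure (F : List (List Bool)) : ℚ :=
  letI k := (F.map List.length).foldr max 0
  ((Finset.univ.filter fun v : Fin k → Bool =>
      ∃ σ ∈ F, σ <+: List.ofFn v).card : ℚ) / 2 ^ k

/-- The clopen subset of Cantor space given explicitly as a finite union of
basic clopen sets. -/
def ClopSet (F : List (List Bool)) : Set (ℕ → Bool) := ⋃ σ ∈ F, Cyl σ

/-- The effectively open subset of Cantor space enumerated by the sequence of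
finite stages `g`. -/
def OpenSet (g : ℕ → List (List Bool)) : Set (ℕ → Bool) := ⋃ s, ClopSet (g s)

/-- The measure of the open set enumerated by the stages `g`: the supremum of the
measures of its finite partial unions. -/
noncomputable def openMeasure (g : ℕ → List (List Bool)) : ℝ :=
  ⨆ s : ℕ, (listMeasure ((List.range (s + 1)).flatMap g) : ℝ)

/-- A Kurtz test relative to `A`: an `A`-computable sequence of explicitly given
clopen sets, the `m`-th of measure at most `2 ^ (-m)`. -/
def KurtzTestIn (A : Set ℕ) (G : ℕ → List (List Bool)) : Prop :=
  ComputableIn A G ∧ ∀ m, listMeasure (G m) ≤ (1 / 2) ^ m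

/-- A (plain) Kurtz test. -/
def KurtzTest (G : ℕ → List (List Bool)) : Prop :=
  Computable G ∧ ∀ m, listMeasure (G m) ≤ (1 / 2) ^ m

/-- A Schnorr test relative to `A`: an `A`-computable doubly indexed sequence of finite
stages such that the `m`-th effectively open set `⋃ s, ClopSet (g m s)` has measure at
most `2 ^ (-m)`, and this measure is a real computable in `A` uniformly in `m`. -/
def SchnorrTestIn (A : Set ℕ) (g : ℕ → ℕ → List (List Bool)) : Prop :=
  ComputableIn A (fun p : ℕ × ℕ => g p.1 p.2) ∧
  (∀ m, openMeasure (g m) ≤ (1 / 2) ^ m) ∧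
  ∃ q : ℕ × ℕ → ℚ, ComputableIn A q ∧
    ∀ m k, |openMeasure (g m) - (q (m, k) : ℝ)| ≤ (1 / 2) ^ k

/-- A (plain) Schnorr test. -/
def SchnorrTest (g : ℕ → ℕ → List (List Bool)) : Prop :=
  Computable (fun p : ℕ × ℕ => g p.1 p.2) ∧
  (∀ m, openMeasure (g m) ≤ (1 / 2) ^ m) ∧
  ∃ q : ℕ × ℕ → ℚ, Computable q ∧
    ∀ m k, |openMeasure (g m) - (q (m, k) : ℝ)| ≤ (1 / 2) ^ k

/-- `N` is Schnorr null relative to `A`. -/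
def SchnorrNullIn (A : Set ℕ) (N : Set (ℕ → Bool)) : Prop :=
  ∃ g, SchnorrTestIn A g ∧ N ⊆ ⋂ m, OpenSet (g m)

/-- `N` is Schnorr null (unrelativized). -/
def SchnorrNull (N : Set (ℕ → Bool)) : Prop :=
  ∃ g, SchnorrTest g ∧ N ⊆ ⋂ m, OpenSet (g m)

/-- `x ∈ 2^ω` is Schnorr random: it belongs to no Schnorr null set. -/
def SchnorrRandom (x : ℕ → Bool) : Prop := ∀ N, SchnorrNull N → x ∉ N

/-- `A` is Kurtz engulfing: there is an `A`-computable sequence of Kurtz tests relative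
to `A` such that every Kurtz null set is contained in the null set of one of them. -/
def KurtzEngulfing (A : Set ℕ) : Prop :=
  ∃ G : ℕ → ℕ → List (List Bool),
    ComputableIn A (fun p : ℕ × ℕ => G p.1 p.2) ∧
    (∀ i m, listMeasure (G i m) ≤ (1 / 2) ^ m) ∧
    ∀ L, KurtzTest L → ∃ i, (⋂ m, ClopSet (L m)) ⊆ ⋂ m, ClopSet (G i m)

/-- `A` is weakly Kurtz engulfing: there is an `A`-computable sequence of Kurtz tests
relative to `A` such that the union of their null sets contains every computable
element of Cantor space. -/
def WeaklyKurtzEngulfing (A : Set ℕ) : Prop :=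
  ∃ G : ℕ → ℕ → List (List Bool),
    ComputableIn A (fun p : ℕ × ℕ => G p.1 p.2) ∧
    (∀ i m, listMeasure (G i m) ≤ (1 / 2) ^ m) ∧
    ∀ x : ℕ → Bool, Computable x → ∃ i, x ∈ ⋂ m, ClopSet (G i m)

/-- `A` is weakly Schnorr engulfing: some set Schnorr null relative to `A` contains
every computable element of Cantor space. -/
def WeaklySchnorrEngulfing (A : Set ℕ) : Prop :=
  ∃ N, SchnorrNullIn A N ∧ ∀ x : ℕ → Bool, Computable x → x ∈ N

/-! ### DNR and PA degrees -/

/-- The `e`-th partial computable function. -/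
noncomputable def phi (e : ℕ) : ℕ →. ℕ := (Denumerable.ofNat Nat.Partrec.Code e).eval

/-- `h` is diagonally nonrecursive. -/
def DNRFun (h : ℕ → ℕ) : Prop := ∀ e, ∀ y ∈ phi e e, h e ≠ y

/-- `A` is DNR: `A` computes a diagonally nonrecursive function. -/
def DNRDegree (A : Set ℕ) : Prop := ∃ h : ℕ → ℕ, ComputableIn A h ∧ DNRFun h

/-- `A` is PA: `A` computes a `{0,1}`-valued diagonally nonrecursive function. -/
def PA (A : Set ℕ) : Prop :=
  ∃ h : ℕ → ℕ, ComputableIn A h ∧ (∀ e, h e ≤ 1) ∧ DNRFun h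

/-! ### Traces -/

/-- The trace `σ` (satisfying `|σ n| ≤ n`) traces the function `f` if
`f n ∈ σ n` for all but finitely many `n`. -/
def Traces (σ : ℕ → Finset ℕ) (f : ℕ → ℕ) : Prop := ∀ᶠ n in atTop, f n ∈ σ n

/-- `σ` is a `(D, g)`-trace relative to `A`: `D` is infinite and c.e. in `A`, `g` is a
partial `A`-computable function with `D ⊆ dom g` and `g n ≥ n` on its domain, and `σ`
is partial `A`-computable, defined on `D`, with `|σ n| < g n` for all `n ∈ D`. -/
def IsDGTraceIn (A : Set ℕ) (D : Set ℕ) (g : ℕ →. ℕ) (σ : ℕ →. Finset ℕ) : Prop :=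
  D.Infinite ∧ CEIn A D ∧ PartrecIn A g ∧ D ⊆ g.Dom ∧ (∀ n, ∀ y ∈ g n, n ≤ y) ∧
  PartrecIn A σ ∧ D ⊆ σ.Dom ∧ ∀ n ∈ D, ∀ S ∈ σ n, ∀ b ∈ g n, S.card < b

/-- `σ` is a `(D, g)`-trace (unrelativized). -/
def IsDGTrace (D : Set ℕ) (g : ℕ →. ℕ) (σ : ℕ →. Finset ℕ) : Prop :=
  D.Infinite ∧ CE D ∧ Partrec g ∧ D ⊆ g.Dom ∧ (∀ n, ∀ y ∈ g n, n ≤ y) ∧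
  Partrec σ ∧ D ⊆ σ.Dom ∧ ∀ n ∈ D, ∀ S ∈ σ n, ∀ b ∈ g n, S.card < b

/-- The `(D, g)`-trace `σ` traces `f`: `f n ∈ σ n` for all but finitely many `n ∈ D`. -/
def DGTraces (D : Set ℕ) (σ : ℕ →. Finset ℕ) (f : ℕ → ℕ) : Prop :=
  ∀ᶠ n in atTop, n ∈ D → ∀ S ∈ σ n, f n ∈ S


/-- The initial segment of `x` of length `n`. -/
def initSeg (x : ℕ → Bool) (n : ℕ) : List Bool := (List.range n).map x

@[simp] theorem length_initSeg (x : ℕ → Bool) (n : ℕ) : (initSeg x n).length = n := by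
  simp [initSeg]

theorem getElem?_initSeg (x : ℕ → Bool) {n i : ℕ} (h : i < n) :
    (initSeg x n)[i]? = some (x i) := by
  simp [initSeg, h]

theorem initSeg_succ (x : ℕ → Bool) (n : ℕ) : initSeg x (n + 1) = initSeg x n ++ [x n] := by
  simp [initSeg, List.range_succ]

theorem take_initSeg (x : ℕ → Bool) {m n : ℕ} (h : m ≤ n) :
    (initSeg x n).take m = initSeg x m := by
  simp [initSeg, ← List.map_take, List.take_range, h]

open scoped Classical in
/-- The characteristic sequence of `A`. -/
noncomputable def charSeq (A : Set ℕ) (n : ℕ) : Bool := decide (n ∈ A)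

theorem indicator_eq_some (A : Set ℕ) (n : ℕ) :
    A.indicator (fun _ => (1 : Part ℕ)) n = Part.some (bif charSeq A n then 1 else 0) := by
  by_cases h : n ∈ A <;> simp [charSeq, h] <;> rfl

/-! ### Stage approximations of oracle computations -/

theorem RecursiveIn.of_partrec (A : Set ℕ) {f : ℕ →. ℕ} (hf : Nat.Partrec f) :
    RecursiveIn A f := by
  induction hf with
  | zero => exact .zero
  | succ => exact .succ
  | left => exact .left
  | right => exact .right
  | pair _ _ h₁ h₂ => exact .pair h₁ h₂
  | comp _ _ h₁ h₂ => exact .comp h₁ h₂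
  | prec _ _ h₁ h₂ => exact .prec h₁ h₂
  | rfind _ h => exact .rfind h

theorem RecursiveIn.of_eq {A : Set ℕ} {f g : ℕ →. ℕ} (hf : RecursiveIn A f)
    (h : ∀ n, f n = g n) : RecursiveIn A g :=
  (funext h : f = g) ▸ hf

/-- Every function partial recursive in `A` is the limit of primitive recursive
approximations that only see finite initial segments of `A`. -/
theorem RecursiveIn.exists_stages {A : Set ℕ} {f : ℕ →. ℕ} (hf : RecursiveIn A f) :
    ∃ F : List Bool → ℕ → Option ℕ, Primrec₂ F ∧
      (∀ k n y, F (initSeg (charSeq A) k) n = some y → y ∈ f n) ∧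
      ∀ n y, y ∈ f n → ∀ᶠ k in atTop, F (initSeg (charSeq A) k) n = some y := by
  induction hf with
  | zero =>
    refine ⟨fun _ _ => some 0, Primrec₂.const _, ?_, ?_⟩ <;>
      simp [pure, PFun.pure, eq_comm]
  | succ =>
    refine ⟨fun _ n => some n.succ, Primrec.option_some.comp (Primrec.succ.comp .snd), ?_, ?_⟩ <;>
      simp [eq_comm]
  | left =>
    refine ⟨fun _ n => some n.unpair.1,
      Primrec.option_some.comp (Primrec.fst.comp (Primrec.unpair.comp .snd)), ?_, ?_⟩ <;>
      simp [eq_comm]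
  | right =>
    refine ⟨fun _ n => some n.unpair.2,
      Primrec.option_some.comp (Primrec.snd.comp (Primrec.unpair.comp .snd)), ?_, ?_⟩ <;>
      simp [eq_comm]
  | oracle =>
    refine ⟨fun l n => l[n]?.map fun b => bif b then 1 else 0,
      Primrec.option_map (Primrec.list_getElem?.comp .fst .snd)
        ((Primrec.dom_bool fun b => bif b then 1 else 0).comp .snd).to₂, ?_, ?_⟩
    · intro k n y h
      beta_reduce
      rw [indicator_eq_some, Part.mem_some_iff]
      by_cases hn : n < k
      · simpa [getElem?_initSeg _ hn, eq_comm] using h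
      · simp [List.getElem?_eq_none (show (initSeg (charSeq A) k).length ≤ n by simpa using hn)]
          at h
    · intro n y h
      beta_reduce at h
      rw [indicator_eq_some, Part.mem_some_iff] at h
      filter_upwards [eventually_gt_atTop n] with k hk
      simp [getElem?_initSeg _ hk, h]
  | @pair f g _ _ ihf ihg =>
    obtain ⟨F, pF, sF, cF⟩ := ihf
    obtain ⟨G, pG, sG, cG⟩ := ihg
    refine ⟨fun l n => (F l n).bind fun a => (G l n).map fun b => Nat.pair a b,
      Primrec.option_bind pF (Primrec.option_map (pG.comp (Primrec.fst.comp .fst)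
        (Primrec.snd.comp .fst)) (Primrec₂.natPair.comp (Primrec.snd.comp .fst) .snd).to₂).to₂,
      ?_, ?_⟩
    · intro k n y h
      simp only [Option.bind_eq_some_iff, Option.map_eq_some_iff] at h
      obtain ⟨a, ha, b, hb, rfl⟩ := h
      simp only [Seq.seq, Part.mem_bind_iff, Part.map_eq_map, Part.mem_map_iff]
      exact ⟨_, ⟨a, sF _ _ _ ha, rfl⟩, b, sG _ _ _ hb, rfl⟩
    · intro n y h
      simp only [Seq.seq, Part.mem_bind_iff, Part.map_eq_map, Part.mem_map_iff] at h
      obtain ⟨_, ⟨a, ha, rfl⟩, b, hb, rfl⟩ := h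
      filter_upwards [cF _ _ ha, cG _ _ hb] with k h₁ h₂
      simp [h₁, h₂]
  | @comp f g _ _ ihf ihg =>
    obtain ⟨F, pF, sF, cF⟩ := ihf
    obtain ⟨G, pG, sG, cG⟩ := ihg
    refine ⟨fun l n => (G l n).bind (F l),
      Primrec.option_bind pG (pF.comp (Primrec.fst.comp .fst) .snd).to₂, ?_, ?_⟩
    · intro k n y h
      obtain ⟨a, ha, hb⟩ := Option.bind_eq_some_iff.1 h
      exact Part.mem_bind_iff.2 ⟨a, sG _ _ _ ha, sF _ _ _ hb⟩
    · intro n y h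
      obtain ⟨a, ha, hb⟩ := Part.mem_bind_iff.1 h
      filter_upwards [cG _ _ ha, cF _ _ hb] with k h₁ h₂
      simp [h₁, h₂]
  | @prec f g _ _ ihf ihg =>
    obtain ⟨F, pF, sF, cF⟩ := ihf
    obtain ⟨G, pG, sG, cG⟩ := ihg
    let H : List Bool → ℕ → ℕ → Option ℕ := fun l a n =>
      n.rec (F l a) fun y IH => IH.bind fun i => G l (Nat.pair a (Nat.pair y i))
    have pH : Primrec fun p : List Bool × ℕ => H p.1 p.2.unpair.1 p.2.unpair.2 := by
      have h : Primrec₂ fun (p : List Bool × ℕ) (q : ℕ × Option ℕ) =>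
          q.2.bind fun i => G p.1 (Nat.pair p.2.unpair.1 (Nat.pair q.1 i)) :=
        Primrec.option_bind (Primrec.snd.comp .snd)
          (pG.comp (Primrec.fst.comp (Primrec.fst.comp .fst))
            (Primrec₂.natPair.comp
              (Primrec.fst.comp (Primrec.unpair.comp (Primrec.snd.comp (Primrec.fst.comp .fst))))
              (Primrec₂.natPair.comp (Primrec.fst.comp (Primrec.snd.comp .fst)) .snd))).to₂
      exact Primrec.nat_rec' (Primrec.snd.comp (Primrec.unpair.comp .snd))
        (pF.comp .fst (Primrec.fst.comp (Primrec.unpair.comp .snd))) h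
    refine ⟨fun l n => H l n.unpair.1 n.unpair.2, pH, ?_, ?_⟩
    · intro k n
      simp only [Nat.unpaired]
      generalize n.unpair.1 = a
      induction n.unpair.2 with
      | zero => exact fun y h => sF _ _ _ h
      | succ m ih =>
        intro y h
        obtain ⟨i, hi, hb⟩ := Option.bind_eq_some_iff.1 h
        exact Part.mem_bind_iff.2 ⟨i, ih _ hi, sG _ _ _ hb⟩
    · intro n
      simp only [Nat.unpaired]
      generalize n.unpair.1 = a
      induction n.unpair.2 with
      | zero => exact fun y h => cF _ _ h
      | succ m ih =>
        intro y h
        obtain ⟨i, hi, hb⟩ := Part.mem_bind_iff.1 h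
        filter_upwards [ih _ hi, cG _ _ hb] with k h₁ h₂
        exact Option.bind_eq_some_iff.2 ⟨i, h₁, h₂⟩
  | @rfind f _ ih =>
    obtain ⟨F, pF, sF, cF⟩ := ih
    let p : List Bool × ℕ → ℕ → Bool := fun q n =>
      (F q.1 (Nat.pair q.2 n)).casesOn true fun y => y == 0
    let μ : List Bool × ℕ → ℕ := fun q => (List.range q.1.length).findIdx (p q)
    have pp : Primrec₂ p :=
      Primrec.option_casesOn (pF.comp (Primrec.fst.comp .fst)
        (Primrec₂.natPair.comp (Primrec.snd.comp .fst) .snd)) (.const true)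
        (Primrec.beq.comp .snd (.const 0)).to₂
    have pμ : Primrec μ :=
      Primrec.list_findIdx (Primrec.list_range.comp (Primrec.list_length.comp .fst)) pp
    have before : ∀ q n, n < μ q → ∃ y, F q.1 (Nat.pair q.2 n) = some (y + 1) := by
      intro q n hn
      have h := List.not_of_lt_findIdx hn
      have hlt := lt_of_lt_of_le hn (List.findIdx_le_length)
      rw [List.getElem_range] at h
      simp only [p] at h
      rcases e : F q.1 (Nat.pair q.2 n) with _ | _ | y
      · simp [e] at h
      · simp [e] at h
      · exact ⟨y, rfl⟩
    refine ⟨fun l a => (F l (Nat.pair a (μ (l, a)))).bind fun y =>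
        bif y == 0 then some (μ (l, a)) else none, ?_, ?_, ?_⟩
    · exact Primrec.option_bind (pF.comp .fst (Primrec₂.natPair.comp .snd pμ))
        (Primrec.cond (Primrec.beq.comp .snd (.const 0))
          (Primrec.option_some.comp (pμ.comp .fst)) (.const none)).to₂
    · intro k a y h
      obtain ⟨z, hz, hy⟩ := Option.bind_eq_some_iff.1 h
      rcases z with _ | z
      · simp only [BEq.rfl, cond_true, Option.some.injEq] at hy
        rw [hy] at hz
        refine Nat.mem_rfind.2 ⟨?_, ?_⟩
        · exact Part.mem_map_iff _ |>.2 ⟨0, sF _ _ _ hz, by simp⟩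
        · intro m hm
          obtain ⟨w, hw⟩ := before (initSeg (charSeq A) k, a) m (hy ▸ hm)
          exact Part.mem_map_iff _ |>.2 ⟨w + 1, sF _ _ _ hw, by simp⟩
      · simp at hy
    · intro a y h
      obtain ⟨h₀, h₁⟩ := Nat.mem_rfind.1 h
      obtain ⟨z, hz, hz0⟩ := Part.mem_map_iff _ |>.1 h₀
      obtain rfl : z = 0 := by simpa using hz0
      have h₂ : ∀ᶠ k in atTop, ∀ m ∈ Finset.range y,
          ∃ w, F (initSeg (charSeq A) k) (Nat.pair a m) = some (w + 1) := by
        refine (Filter.eventually_all_finset _).2 fun m hm => ?_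
        obtain ⟨w, hw, hw0⟩ := Part.mem_map_iff _ |>.1 (h₁ (Finset.mem_range.1 hm))
        obtain ⟨w, rfl⟩ := Nat.exists_eq_succ_of_ne_zero (n := w) (by simpa using hw0)
        filter_upwards [cF _ _ hw] with k hk using ⟨w, hk⟩
      filter_upwards [cF _ _ hz, h₂, eventually_gt_atTop y] with k e₀ e₁ hk
      have : μ (initSeg (charSeq A) k, a) = y := by
        refine (List.findIdx_eq (by simpa using hk)).2 ⟨?_, ?_⟩
        · simp [p, e₀]
        · intro j hj
          obtain ⟨w, hw⟩ := e₁ j (Finset.mem_range.2 hj)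
          simp [p, hw]
      simp [this, e₀]

theorem RecursiveIn.of_computable (A : Set ℕ) {f : ℕ → ℕ} (hf : Computable f) :
    RecursiveIn A (f : ℕ →. ℕ) :=
  .of_partrec A (Partrec.nat_iff.1 hf)

theorem RecursiveIn.comp_total {A : Set ℕ} {f : ℕ →. ℕ} {g : ℕ → ℕ} (hf : RecursiveIn A f)
    (hg : RecursiveIn A (g : ℕ →. ℕ)) : RecursiveIn A fun n => f (g n) :=
  (hf.comp hg).of_eq fun _ => Part.bind_some _ _

theorem RecursiveIn.pair_total {A : Set ℕ} {f g : ℕ → ℕ} (hf : RecursiveIn A (f : ℕ →. ℕ))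
    (hg : RecursiveIn A (g : ℕ →. ℕ)) :
    RecursiveIn A ((fun n => Nat.pair (f n) (g n) : ℕ → ℕ) : ℕ →. ℕ) :=
  (hf.pair hg).of_eq fun n => by
    change Part.bind (Part.map _ (Part.some (f n))) (fun h => Part.map h (Part.some (g n))) =
      Part.some _
    rw [Part.map_some, Part.bind_some, Part.map_some]

theorem RecursiveIn.charSeq_total (A : Set ℕ) :
    RecursiveIn A ((fun n => bif charSeq A n then 1 else 0 : ℕ → ℕ) : ℕ →. ℕ) :=
  RecursiveIn.oracle.of_eq (indicator_eq_some A)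

theorem RecursiveIn.nat_rec {A : Set ℕ} (z : ℕ) {g : ℕ → ℕ} (hg : RecursiveIn A (g : ℕ →. ℕ)) :
    RecursiveIn A ((fun n => Nat.rec z (fun y i => g (Nat.pair 0 (Nat.pair y i))) n : ℕ → ℕ) :
      ℕ →. ℕ) := by
  refine ((RecursiveIn.prec (RecursiveIn.of_computable A (.const z)) hg).comp_total
    (RecursiveIn.of_computable A (f := fun n => Nat.pair 0 n)
      (Primrec₂.natPair.comp (.const 0) .id).to_comp)).of_eq fun n => ?_
  simp only [Nat.unpaired, Nat.unpair_pair]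
  induction n with
  | zero => rfl
  | succ n ih => exact (congrArg (Part.bind · _) ih).trans (Part.bind_some _ _)

open Encodable in
/-- The coded initial segments of `A` are computable in `A`. -/
theorem RecursiveIn.initSeg_charSeq (A : Set ℕ) :
    RecursiveIn A
      ((fun k => encode (initSeg (charSeq A) k) : ℕ → ℕ) : ℕ →. ℕ) := by
  let c : ℕ → ℕ := fun m =>
    encode ((((decode m.unpair.1 : Option (List Bool)).getD []) ++ [m.unpair.2 == 1]))
  have hc : Primrec c :=
    Primrec.encode.comp (Primrec.list_concat.comp
      (Primrec.option_getD.comp (Primrec.decode.comp (Primrec.fst.comp .unpair)) (.const []))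
      (Primrec.beq.comp (Primrec.snd.comp .unpair) (.const 1)))
  have hi : Primrec fun m : ℕ => m.unpair.2.unpair.2 :=
    Primrec.snd.comp (Primrec.unpair.comp (Primrec.snd.comp .unpair))
  have hy : Primrec fun m : ℕ => m.unpair.2.unpair.1 :=
    Primrec.fst.comp (Primrec.unpair.comp (Primrec.snd.comp .unpair))
  refine (RecursiveIn.nat_rec (encode ([] : List Bool))
    (g := fun m => c (Nat.pair m.unpair.2.unpair.2
      (bif charSeq A m.unpair.2.unpair.1 then 1 else 0)))
    ((RecursiveIn.of_computable A hc.to_comp).comp_total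
      ((RecursiveIn.of_computable A hi.to_comp).pair_total
        ((RecursiveIn.charSeq_total A).comp_total (RecursiveIn.of_computable A hy.to_comp))))).of_eq
    fun k => congrArg Part.some ?_
  induction k with
  | zero => rfl
  | succ k ih =>
    have hk : ((bif charSeq A k then 1 else 0) == 1) =
        charSeq A k := by
      cases charSeq A k <;> rfl
    simp only [Nat.unpair_pair] at ih ⊢
    rw [ih]
    simp [c, initSeg_succ, hk]

theorem RecursiveIn.rfind_total {A : Set ℕ} {g : ℕ → ℕ} (hg : RecursiveIn A (g : ℕ →. ℕ)) :
    RecursiveIn A fun a => Nat.rfind fun n => Part.some (decide (g (Nat.pair a n) = 0)) :=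
  hg.rfind.of_eq fun _ => congrArg Nat.rfind (funext fun _ => Part.map_some _ _)

theorem rfind_some_dom (p : ℕ → Bool) :
    (Nat.rfind fun k => Part.some (p k)).Dom ↔ ∃ k, p k = true :=
  Nat.rfind_dom.trans <| exists_congr fun _ =>
    ⟨fun h => (Part.mem_some_iff.1 h.1).symm,
      fun h => ⟨Part.mem_some_iff.2 h.symm, fun _ => trivial⟩⟩

section

variable {α : Type} [Primcodable α]

open Encodable in
/-- Unbounded search over the finite initial segments of `A` is partial recursive in `A`. -/
theorem PartrecIn.rfind_initSeg (A : Set ℕ) {P : List Bool → α → Bool} (hP : Computable₂ P) :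
    PartrecIn A fun a : α => Nat.rfind fun k => Part.some (P (initSeg (charSeq A) k) a) := by
  let g : ℕ → ℕ := fun m => Option.casesOn (decode m.unpair.1 : Option α) 1 fun a =>
    bif P ((decode m.unpair.2 : Option (List Bool)).getD []) a then 0 else 1
  have hg : Computable g :=
    Computable.option_casesOn
      (Computable.decode.comp (Computable.fst.comp .unpair)) (.const 1)
      (Computable.cond (hP.comp (Computable.option_getD
        (Computable.decode.comp (Computable.snd.comp (Computable.unpair.comp .fst)))
        (.const [])) .snd) (.const 0) (.const 1)).to₂
  refine (RecursiveIn.rfind_total (g := fun m => g (Nat.pair m.unpair.1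
    (encode (initSeg (charSeq A) m.unpair.2)))) ((RecursiveIn.of_computable A hg).comp_total
      (RecursiveIn.pair_total .left
        ((RecursiveIn.initSeg_charSeq A).comp_total .right)))).of_eq fun n => ?_
  rcases e : (decode n : Option α) with _ | a
  · refine (Part.eq_none_iff.2 fun y hy => ?_).trans (Part.eq_none_iff.2 fun y hy => ?_).symm
    · simpa [g, e] using (Nat.mem_rfind.1 hy).1
    · simp at hy
  · simp only [Part.coe_some, Part.bind_some]
    rw [show (encode : ℕ → ℕ) = id from rfl, Part.map_id']
    · congr 1
      funext k
      simp only [g, Nat.unpair_pair, e, encodek, Option.getD_some]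
      cases P (initSeg (charSeq A) k) a <;> simp
    · simp

theorem CEIn.exists_stages {A : Set ℕ} {W : Set α} (hW : CEIn A W) :
    ∃ P : List Bool → α → Bool, Computable₂ P ∧
      ∀ a, a ∈ W ↔ ∃ k, P (initSeg (charSeq A) k) a = true := by
  obtain ⟨f, hf, hfW⟩ := hW
  obtain ⟨F, pF, sF, cF⟩ := RecursiveIn.exists_stages hf
  refine ⟨fun l a => (F l (Encodable.encode a)).isSome,
    (Primrec.option_isSome.comp (pF.comp .fst (Primrec.encode.comp .snd))).to_comp, fun a => ?_⟩
  rw [hfW]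
  constructor
  · intro h
    obtain ⟨k, hk⟩ := (cF (Encodable.encode a) ((f a).get h) (by
      simp only [Encodable.encodek, Part.coe_some, Part.bind_some]
      exact Part.mem_map_iff _ |>.2 ⟨_, Part.get_mem h, rfl⟩)).exists
    exact ⟨k, by simp [hk]⟩
  · rintro ⟨k, hk⟩
    obtain ⟨y, hy⟩ := Option.isSome_iff_exists.1 hk
    have := sF _ _ _ hy
    simp only [Encodable.encodek, Part.coe_some, Part.bind_some] at this
    obtain ⟨z, hz, -⟩ := Part.mem_map_iff _ |>.1 this
    exact hz.1

theorem CEIn.of_stages (A : Set ℕ) {P : List Bool → α → Bool} (hP : Computable₂ P) :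
    CEIn A {a | ∃ k, P (initSeg (charSeq A) k) a = true} :=
  ⟨_, PartrecIn.rfind_initSeg A hP, fun _ => (rfind_some_dom _).symm⟩

theorem CEIn.preimage {A : Set ℕ} {β : Type} [Primcodable β] {W : Set α} (hW : CEIn A W)
    {h : β → α} (hh : Computable h) : CEIn A (h ⁻¹' W) := by
  obtain ⟨P, hP, hPW⟩ := hW.exists_stages
  convert CEIn.of_stages A (P := fun l b => P l (h b)) (hP.comp .fst (hh.comp .snd)) using 1
  ext b
  exact hPW (h b)

theorem CE.exists_stages {W : Set α} (hW : CE W) :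
    ∃ P : ℕ → α → Bool, Computable₂ P ∧ ∀ a, a ∈ W ↔ ∃ k, P k a = true := by
  obtain ⟨f, hf, hfW⟩ := hW
  obtain ⟨P, hP, hPW⟩ := CEIn.exists_stages (A := ∅) ⟨f, RecursiveIn.of_partrec ∅ hf, hfW⟩
  have hc : charSeq ∅ = fun _ => false := by funext; simp [charSeq]
  refine ⟨fun k a => P (initSeg (charSeq ∅) k) a, hP.comp ?_ .snd, hPW⟩
  rw [hc]
  exact (Primrec.list_map (Primrec.list_range.comp .fst) (Primrec₂.const false)).to_comp

theorem CE.range {β : Type} [Primcodable β] {e : β → α} (he : Computable e) :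
    CE (Set.range e) := by
  let p : α → ℕ → Bool := fun a n => Option.casesOn (Encodable.decode n : Option β) false fun b =>
    Encodable.encode (e b) == Encodable.encode a
  have hp : Computable₂ p :=
    Computable.option_casesOn (Computable.decode.comp .snd) (.const false)
      (Primrec.beq.to_comp.comp (Computable.encode.comp (he.comp .snd))
        (Computable.encode.comp (Computable.fst.comp .fst))).to₂
  refine ⟨fun a => Nat.rfind fun n => Part.some (p a n), Partrec.rfind hp.partrec₂, fun a => ?_⟩
  rw [rfind_some_dom]
  constructor
  · rintro ⟨b, rfl⟩
    exact ⟨Encodable.encode b, by simp [p]⟩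
  · rintro ⟨n, hn⟩
    simp only [p] at hn
    rcases h : (Encodable.decode n : Option β) with _ | b
    · simp [h] at hn
    · exact ⟨b, by simpa [h] using hn⟩

end

/-- A total function finding the least stage of `A` with a computable property is dominated
by a computable function, if `A` is not of hyperimmune degree. -/
theorem exists_computable_bound {A : Set ℕ} (hA : ¬ HyperimmuneDegree A)
    {P : List Bool → ℕ → Bool} (hP : Computable₂ P)
    (h : ∀ n, ∃ k, P (initSeg (charSeq A) k) n = true) :
    ∃ q : ℕ → ℕ, Computable q ∧ ∀ n, ∃ k ≤ q n, P (initSeg (charSeq A) k) n = true := by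
  classical
  let f : ℕ → ℕ := fun n => Nat.find (h n)
  have hf : ComputableIn A f := by
    suffices e : (f : ℕ →. ℕ) = fun n => Nat.rfind fun k =>
        Part.some (P (initSeg (charSeq A) k) n) by
      unfold ComputableIn
      rw [e]
      exact PartrecIn.rfind_initSeg A hP
    funext n
    refine (Part.eq_some_iff.2 (Nat.mem_rfind.2 ⟨?_, fun {m} hm => ?_⟩)).symm
    · simpa using (Nat.find_spec (h n)).symm
    · simpa using Nat.find_min (h n) hm
  have : ∃ g : ℕ → ℕ, Computable g ∧ ∀ᶠ n in atTop, f n ≤ g n := by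
    by_contra! hcon
    exact hA ⟨f, hf, fun g hg => by simpa using hcon g hg⟩
  obtain ⟨g, hg, hfg⟩ := this
  obtain ⟨N, hN⟩ := eventually_atTop.1 hfg
  refine ⟨fun n => g n + (Finset.range N).sup f,
    Primrec.nat_add.to_comp.comp hg (.const _), fun n => ⟨f n, ?_, Nat.find_spec (h n)⟩⟩
  rcases lt_or_ge n N with hn | hn
  · exact (Finset.le_sup (f := f) (Finset.mem_range.2 hn)).trans (Nat.le_add_left _ _)
  · exact (hN n hn).trans (Nat.le_add_right _ _)


/-! ### Cylinders and nowhere density -/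

theorem mem_Cyl_initSeg {x y : ℕ → Bool} {n : ℕ} :
    y ∈ Cyl (initSeg x n) ↔ ∀ i < n, y i = x i := by
  simp only [Cyl, Set.mem_ofPred_eq, length_initSeg]
  refine forall₂_congr fun i hi => ?_
  simp [List.getD_eq_getElem?_getD, getElem?_initSeg x hi]

theorem mem_Cyl_initSeg_self (x : ℕ → Bool) (n : ℕ) : x ∈ Cyl (initSeg x n) :=
  mem_Cyl_initSeg.2 fun _ _ => rfl

theorem mem_Cyl_iff_getElem {x : ℕ → Bool} {σ : List Bool} :
    x ∈ Cyl σ ↔ ∀ i (h : i < σ.length), x i = σ[i] := by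
  refine forall₂_congr fun i hi => ?_
  rw [List.getD_eq_getElem _ _ hi]

theorem mem_Cyl_iff {x : ℕ → Bool} {σ : List Bool} : x ∈ Cyl σ ↔ initSeg x σ.length = σ := by
  rw [mem_Cyl_iff_getElem, List.ext_getElem_iff]
  simp [initSeg]

theorem getElem?_eq_some_of_isPrefix {σ τ : List Bool} (h : σ <+: τ) {i : ℕ} {b : Bool}
    (hb : σ[i]? = some b) : τ[i]? = some b := by
  obtain ⟨hi, rfl⟩ := List.getElem?_eq_some_iff.1 hb
  exact List.prefix_iff_getElem?.1 h i hi

theorem Cyl_subset_of_isPrefix {σ τ : List Bool} (h : σ <+: τ) : Cyl τ ⊆ Cyl σ := fun _ hx =>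
  mem_Cyl_iff_getElem.2 fun i hi =>
    (mem_Cyl_iff_getElem.1 hx i (hi.trans_le h.length_le)).trans (h.getElem hi).symm

theorem nonempty_Cyl (σ : List Bool) : (Cyl σ).Nonempty :=
  ⟨fun i => σ.getD i false, fun _ _ => rfl⟩

theorem isPrefix_of_mem_Cyl {x : ℕ → Bool} {σ τ : List Bool} (hσ : x ∈ Cyl σ) (hτ : x ∈ Cyl τ)
    (h : σ.length ≤ τ.length) : σ <+: τ := by
  rw [← mem_Cyl_iff.1 hσ, ← mem_Cyl_iff.1 hτ, ← take_initSeg x h]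
  exact List.take_prefix _ _

theorem Cyl_eq_cylinder (σ : List Bool) :
    Cyl σ = PiNat.cylinder (fun i => σ.getD i false) σ.length := rfl

theorem isOpen_Cyl (σ : List Bool) : IsOpen (Cyl σ) := by
  rw [Cyl_eq_cylinder]
  exact PiNat.isOpen_cylinder _ _ _

theorem exists_Cyl_subset {U : Set (ℕ → Bool)} (hU : IsOpen U) {x : ℕ → Bool} (hx : x ∈ U) :
    ∃ n, Cyl (initSeg x n) ⊆ U := by
  obtain ⟨_, ⟨y, n, rfl⟩, hxy, hyU⟩ :=
    (PiNat.isTopologicalBasis_cylinders fun _ : ℕ => Bool).exists_subset_of_mem_open hx hU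
  refine ⟨n, fun z hz => hyU fun i hi => ?_⟩
  rw [mem_Cyl_initSeg.1 hz i hi, hxy i hi]

/-- The complement of a union of cylinders is nowhere dense iff that union is dense. -/
theorem isNowhereDense_compl_iff {V : Set (List Bool)} :
    IsNowhereDense (⋃ σ ∈ V, Cyl σ)ᶜ ↔ ∀ σ, ∃ x ∈ Cyl σ, ∃ τ ∈ V, x ∈ Cyl τ := by
  have hc : IsClosed (⋃ σ ∈ V, Cyl σ)ᶜ :=
    (isOpen_biUnion fun σ _ => isOpen_Cyl σ).isClosed_compl
  rw [hc.isNowhereDense_iff, interior_compl, Set.compl_empty_iff, ← dense_iff_closure_eq,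
    dense_iff_inter_open]
  constructor
  · intro h σ
    obtain ⟨x, hx, hxV⟩ := h _ (isOpen_Cyl σ) (nonempty_Cyl σ)
    simp only [Set.mem_iUnion] at hxV
    obtain ⟨τ, hτ, hxτ⟩ := hxV
    exact ⟨x, hx, τ, hτ, hxτ⟩
  · rintro h U hU ⟨x, hx⟩
    obtain ⟨n, hn⟩ := exists_Cyl_subset hU hx
    obtain ⟨y, hy, τ, hτ, hyτ⟩ := h (initSeg x n)
    exact ⟨y, hn hy, Set.mem_biUnion hτ hyτ⟩

/-- The point determined by an increasing sequence of strings. -/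
theorem exists_mem_iInter_Cyl {s : ℕ → List Bool} (hs : ∀ n, s n <+: s (n + 1))
    (hl : ∀ n, n ≤ (s n).length) (n : ℕ) :
    (fun i => (s (i + 1)).getD i false) ∈ Cyl (s n) := by
  have hmono : ∀ {a b}, a ≤ b → s a <+: s b := fun {a b} hab => by
    induction hab with
    | refl => exact List.prefix_refl _
    | step _ ih => exact ih.trans (hs _)
  refine mem_Cyl_iff_getElem.2 fun i hi => ?_
  have hi' : i < (s (i + 1)).length := hl (i + 1)
  rw [List.getD_eq_getElem _ _ hi']
  rcases le_total n (i + 1) with h | h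
  · exact ((hmono h).getElem hi).symm
  · exact (hmono h).getElem hi'

/-! ### Effectively meager sets -/

/-- Effective meagerness through a computable strategy for leaving each of the classes. -/
theorem effMeager_iff {T : Set (ℕ → Bool)} :
    EffMeager T ↔ ∃ e : ℕ → List Bool → List Bool, Computable₂ e ∧ (∀ m σ, σ <+: e m σ) ∧
      ∀ x ∈ T, ∃ m, ∀ σ, x ∉ Cyl (e m σ) := by
  constructor
  · rintro ⟨C, ⟨W, hW, hC⟩, hN, hT⟩
    obtain ⟨P, hP, hPW⟩ := hW.exists_stages
    let p : ℕ → List Bool → ℕ × List Bool × ℕ → Bool := fun m σ t =>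
      P t.1 (m, (σ ++ t.2.1).take t.2.2)
    have hp : Computable fun q : (ℕ × List Bool) × (ℕ × List Bool × ℕ) => p q.1.1 q.1.2 q.2 :=
      hP.comp (Computable.fst.comp .snd) ((Computable.fst.comp .fst).pair
        (Primrec.list_take.to_comp.comp
          (Computable.snd.comp (Computable.snd.comp .snd))
          (Computable.list_append.comp (Computable.snd.comp .fst)
            (Computable.fst.comp (Computable.snd.comp .snd)))))
    have hex : ∀ m σ, ∃ t, p m σ t = true := by
      intro m σ
      have := hN m
      rw [hC m, isNowhereDense_compl_iff] at this
      obtain ⟨x, hx, τ, hτ, hxτ⟩ := this σ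
      obtain ⟨k, hk⟩ := (hPW _).1 hτ
      obtain ⟨δ, hδ⟩ := isPrefix_of_mem_Cyl hx (mem_Cyl_initSeg_self x (σ.length + τ.length))
        (by simp)
      refine ⟨(k, δ, τ.length), ?_⟩
      simp only [p]
      rw [hδ, take_initSeg x (by omega), mem_Cyl_iff.1 hxτ]
      exact hk
    let s : ℕ × List Bool → ℕ → Option (ℕ × List Bool × ℕ) := fun q n =>
      (Encodable.decode n : Option (ℕ × List Bool × ℕ)).bind fun t =>
        bif p q.1 q.2 t then some t else none
    have hs : Computable₂ s :=
      Computable.option_bind (Computable.decode.comp .snd)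
        (Computable.cond (hp.comp ((Computable.fst.comp .fst).pair .snd))
          (Computable.option_some.comp .snd) (.const none)).to₂
    have hdom : ∀ q, (Nat.rfindOpt (s q)).Dom := by
      intro q
      obtain ⟨t, ht⟩ := hex q.1 q.2
      exact Nat.rfindOpt_dom.2 ⟨Encodable.encode t, t, by
        simp only [s, Encodable.encodek, Option.bind_some, ht, cond_true, Option.mem_def]⟩
    let g : ℕ × List Bool → ℕ × List Bool × ℕ := fun q => (Nat.rfindOpt (s q)).get (hdom q)
    have hg : Computable g :=
      (Partrec.rfindOpt hs).of_eq fun q => (Part.some_get (hdom q)).symm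
    have hgp : ∀ q, p q.1 q.2 (g q) = true := by
      intro q
      obtain ⟨n, hn⟩ := Nat.rfindOpt_spec (Part.get_mem (hdom q))
      obtain ⟨t, -, ht⟩ := Option.bind_eq_some_iff.1 hn
      change (bif p q.1 q.2 t then some t else none) = some (g q) at ht
      cases h : p q.1 q.2 t
      · simp [h] at ht
      · simp only [h, cond_true, Option.some.injEq] at ht
        rw [← ht, h]
    refine ⟨fun m σ => σ ++ (g (m, σ)).2.1, ?_, fun m σ => List.prefix_append _ _, ?_⟩
    · exact Computable.list_append.comp .snd (Computable.fst.comp (Computable.snd.comp hg))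
    · intro x hx
      obtain ⟨m, hm⟩ := Set.mem_iUnion.1 (hT hx)
      refine ⟨m, fun σ hxσ => ?_⟩
      rw [hC m] at hm
      exact hm (Set.mem_biUnion ((hPW _).2 ⟨_, hgp (m, σ)⟩)
        (Cyl_subset_of_isPrefix (List.take_prefix _ _) hxσ))
  · rintro ⟨e, he, hpre, hT⟩
    refine ⟨_, ⟨Set.range fun q : ℕ × List Bool => (q.1, e q.1 q.2),
      CE.range (Computable.fst.pair he), fun m => rfl⟩, fun m => ?_, fun x hx => ?_⟩
    · refine isNowhereDense_compl_iff.2 fun σ => ?_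
      obtain ⟨x, hx⟩ := nonempty_Cyl (e m σ)
      exact ⟨x, Cyl_subset_of_isPrefix (hpre m σ) hx, e m σ, ⟨(m, σ), rfl⟩, hx⟩
    · obtain ⟨m, hm⟩ := hT x hx
      refine Set.mem_iUnion.2 ⟨m, ?_⟩
      simp only [Set.mem_compl_iff, Set.mem_iUnion, not_exists]
      rintro τ ⟨⟨m', σ⟩, hσ⟩ hxτ
      simp only [Prod.mk.injEq] at hσ
      obtain ⟨rfl, rfl⟩ := hσ
      exact hm σ hxτ

/-- The effective Baire category theorem. -/
theorem EffMeager.exists_computable_notMem {T : Set (ℕ → Bool)} (hT : EffMeager T) :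
    ∃ x : ℕ → Bool, Computable x ∧ x ∉ T := by
  obtain ⟨e, he, hpre, hT⟩ := effMeager_iff.1 hT
  let s : ℕ → List Bool := fun n => Nat.rec [] (fun n σ => e n σ ++ [false]) n
  have hs : Computable s :=
    Computable.nat_rec .id (.const []) (Computable.list_concat.comp
      (he.comp (Computable.fst.comp .snd) (Computable.snd.comp .snd)) (.const false)).to₂
  have hs_pre : ∀ n, s n <+: s (n + 1) := fun n => (hpre n _).trans (List.prefix_append _ _)
  have hl : ∀ n, n ≤ (s n).length := by
    intro n
    induction n with
    | zero => exact Nat.zero_le _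
    | succ n ih =>
      have := (hpre n (s n)).length_le
      change n + 1 ≤ (e n (s n) ++ [false]).length
      simp only [List.length_append, List.length_singleton]
      omega
  refine ⟨fun i => (s (i + 1)).getD i false, ?_, fun hx => ?_⟩
  · exact (Primrec.list_getD false).to_comp.comp (hs.comp Computable.succ) .id
  · obtain ⟨m, hm⟩ := hT _ hx
    exact hm (s m) (Cyl_subset_of_isPrefix (List.prefix_append _ [false])
      (exists_mem_iInter_Cyl hs_pre hl (m + 1)))

/-! ### The three implications -/

theorem WeaklyMeagerEngulfing.exists_not_subset {A : Set ℕ} (hA : WeaklyMeagerEngulfing A) :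
    ∃ S, EffMeagerIn A S ∧ ∀ T, EffMeager T → ¬ S ⊆ T := by
  obtain ⟨S, hS, hx⟩ := hA
  refine ⟨S, hS, fun T hT hST => ?_⟩
  obtain ⟨x, hxc, hxT⟩ := hT.exists_computable_notMem
  exact hxT (hST (hx x hxc))

/-- A computable test on initial segments of `A` that eventually accepts every `n`, but not
before stage `f j` for any `j ≤ n`. -/
theorem ComputableIn.exists_delayed_test {A : Set ℕ} {f : ℕ → ℕ} (hf : ComputableIn A f) :
    ∃ Q : List Bool → ℕ → Bool, Primrec₂ Q ∧
      (∀ n, ∃ k, Q (initSeg (charSeq A) k) n = true) ∧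
      ∀ k n, Q (initSeg (charSeq A) k) n = true → ∀ j ≤ n, f j ≤ k := by
  obtain ⟨F, pF, sF, cF⟩ := RecursiveIn.exists_stages hf
  have hval : ∀ n y, (y ∈ Part.bind ↑(Encodable.decode (α := ℕ) n) fun a =>
      ((f : ℕ →. ℕ) a).map Encodable.encode) ↔ y = f n := by
    intro n y
    simp
  let b : ℕ → List Bool → Bool := fun i l =>
    (F l i).casesOn false fun v => decide (v ≤ l.length)
  have pb : Primrec₂ b :=
    Primrec.option_casesOn (pF.comp .snd .fst) (.const false)
      (Primrec.nat_le.decide.comp .snd (Primrec.list_length.comp (Primrec.snd.comp .fst))).to₂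
  have hb : ∀ i l, b i l = true ↔ ∃ v, F l i = some v ∧ v ≤ l.length := by
    intro i l
    simp only [b]
    rcases F l i with _ | v <;> simp
  have pR : PrimrecRel fun i l => b i l = true := Primrec.eq.comp pb (.const true)
  obtain ⟨_, pQ⟩ := pR.forall_mem_list.comp
    (Primrec.list_range.comp (Primrec.succ.comp Primrec.snd)) Primrec.fst
  replace pQ : Primrec₂ fun (l : List Bool) (n : ℕ) =>
      (List.range (n + 1)).all fun i => b i l :=
    pQ.of_eq fun q => by rw [Bool.eq_iff_iff, decide_eq_true_eq, List.all_eq_true]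
  refine ⟨_, pQ, fun n => ?_, fun k n h j hj => ?_⟩
  · have : ∀ᶠ k in atTop, ∀ i ∈ Finset.range (n + 1), b i (initSeg (charSeq A) k) = true := by
      refine (Filter.eventually_all_finset _).2 fun i _ => ?_
      filter_upwards [cF i (f i) ((hval _ _).2 rfl), eventually_ge_atTop (f i)] with k h₁ h₂
      exact (hb _ _).2 ⟨f i, h₁, by simpa using h₂⟩
    obtain ⟨k, hk⟩ := this.exists
    exact ⟨k, List.all_eq_true.2 (by simpa using hk)⟩
  · obtain ⟨v, hv, hvk⟩ := (hb _ _).1 (List.all_eq_true.1 h j (List.mem_range.2 (by omega)))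
    rw [← (hval _ _).1 (sF _ _ _ hv)]
    simpa using hvk

theorem HyperimmuneDegree.exists_not_subset {A : Set ℕ} (hA : HyperimmuneDegree A) :
    ∃ S, EffMeagerIn A S ∧ ∀ T, EffMeager T → ¬ S ⊆ T := by
  obtain ⟨f, hf, hfg⟩ := hA
  obtain ⟨Q, pQ, hQ, hQf⟩ := hf.exists_delayed_test
  let zeros : List Bool → List Bool := fun l => (List.range (l.length + 1)).map fun _ => false
  have pz : Primrec zeros :=
    Primrec.list_map (Primrec.list_range.comp (Primrec.succ.comp Primrec.list_length))
      (Primrec₂.const false)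
  let τ : List Bool → List Bool → List Bool := fun l σ => σ.take (σ.length - (l.length + 1))
  have pτ : Primrec₂ τ :=
    Primrec.list_take.comp (Primrec.nat_sub.comp (Primrec.list_length.comp .snd)
      (Primrec.succ.comp (Primrec.list_length.comp .fst))) .snd
  let P : List Bool → ℕ × List Bool → Bool := fun l q =>
    Q l (τ l q.2).length && decide (τ l q.2 ++ zeros l = q.2)
  have pP : Primrec₂ P :=
    Primrec.and.comp
      (pQ.comp .fst (Primrec.list_length.comp (pτ.comp .fst (Primrec.snd.comp .snd))))
      (Primrec.eq.decide.comp (Primrec.list_append.comp (pτ.comp .fst (Primrec.snd.comp .snd))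
        (pz.comp .fst)) (Primrec.snd.comp .snd))
  let C : ℕ → Set (ℕ → Bool) := fun m =>
    (⋃ σ ∈ {s | (m, s) ∈ {a | ∃ k, P (initSeg (charSeq A) k) a = true}}, Cyl σ)ᶜ
  have hC : ∀ (x : ℕ → Bool), (∀ m k, Q (initSeg (charSeq A) k) m = true →
      ∃ j, m ≤ j ∧ j ≤ m + k ∧ x j = true) → x ∈ C 0 := by
    intro x hx
    simp only [C, Set.mem_compl_iff, Set.mem_iUnion, not_exists]
    rintro σ ⟨k, hk⟩ hxσ
    simp only [P, Bool.and_eq_true, decide_eq_true_eq] at hk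
    obtain ⟨hk, hσ⟩ := hk
    generalize τ (initSeg (charSeq A) k) σ = ρ at hk hσ
    subst hσ
    obtain ⟨j, h₁, h₂, hj⟩ := hx _ _ hk
    have := mem_Cyl_iff_getElem.1 hxσ j (by simp [zeros]; omega)
    rw [List.getElem_append_right h₁] at this
    simp [zeros, hj] at this
  have hCn : ∀ m, IsNowhereDense (C m) := by
    intro m
    refine isNowhereDense_compl_iff.2 fun σ => ?_
    obtain ⟨k, hk⟩ := hQ σ.length
    obtain ⟨x, hx⟩ := nonempty_Cyl (σ ++ zeros (initSeg (charSeq A) k))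
    refine ⟨x, Cyl_subset_of_isPrefix (List.prefix_append _ _) hx, _, ⟨k, ?_⟩, hx⟩
    have : τ (initSeg (charSeq A) k) (σ ++ zeros (initSeg (charSeq A) k)) = σ := by
      simp [τ, zeros]
    simp [P, this, hk]
  refine ⟨C 0, ⟨C, ⟨_, CEIn.of_stages A pP.to_comp, fun m => rfl⟩, hCn,
    Set.subset_iUnion C 0⟩, fun T hT hST => ?_⟩
  obtain ⟨e, he, hpre, hT⟩ := effMeager_iff.1 hT
  let Inv : List Bool → Prop := fun σ => ∀ m < σ.length, ∀ k,
    Q (initSeg (charSeq A) k) m = true → ∃ j, m ≤ j ∧ j ≤ m + k ∧ σ[j]? = some true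
  have step : ∀ i σ, Inv σ →
      ∃ σ', Inv σ' ∧ σ <+: σ' ∧ σ.length < σ'.length ∧ ∃ ρ, e i ρ <+: σ' := by
    intro i σ hσ
    let ones : ℕ → List Bool := fun n => (List.range n).map fun _ => true
    have hones : Computable ones :=
      (Primrec.list_map Primrec.list_range (Primrec₂.const true)).to_comp
    obtain ⟨n, hn⟩ := (hfg (fun n => (e i (σ ++ ones n)).length)
      (Computable.list_length.comp (he.comp (.const i)
        (Computable.list_append.comp (.const σ) hones)))).exists
    have h₁ := hpre i (σ ++ ones n)
    have hl := h₁.length_le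
    simp only [List.length_append] at hl
    have hln : (ones n).length = n := by simp [ones]
    have h₂ : e i (σ ++ ones n) <+: e i (σ ++ ones n) ++ [true] := List.prefix_append _ _
    refine ⟨e i (σ ++ ones n) ++ [true], fun m hm k hk => ?_,
      ((List.prefix_append _ _).trans h₁).trans h₂, by simp; omega, _, h₂⟩
    rcases lt_or_ge m σ.length with hmσ | hmσ
    · obtain ⟨j, hj₁, hj₂, hj⟩ := hσ m hmσ k hk
      exact ⟨j, hj₁, hj₂,
        getElem?_eq_some_of_isPrefix (((List.prefix_append _ _).trans h₁).trans h₂) hj⟩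
    rcases lt_or_ge m (σ.length + n) with hmn | hmn
    · refine ⟨m, le_rfl, by omega, ?_⟩
      refine getElem?_eq_some_of_isPrefix (h₁.trans h₂) ?_
      rw [List.getElem?_append_right hmσ]
      simp [ones, show m - σ.length < n by omega]
    · have := hQf k m hk n (by omega)
      simp only [List.length_append, List.length_singleton] at hm
      exact ⟨(e i (σ ++ ones n)).length, by omega, by omega, by simp⟩
  choose! next hInv hnpre hnlen hne using step
  let s : ℕ → List Bool := fun n => Nat.rec [] next n
  have hs : ∀ n, Inv (s n) := by
    intro n
    induction n with
    | zero => exact fun m hm => absurd hm (Nat.not_lt_zero _)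
    | succ n ih => exact hInv n _ ih
  have hsl : ∀ n, n ≤ (s n).length := by
    intro n
    induction n with
    | zero => exact Nat.zero_le _
    | succ n ih => exact ih.trans_lt (hnlen n _ (hs n))
  have hx := exists_mem_iInter_Cyl (fun n => hnpre n _ (hs n)) hsl
  set x : ℕ → Bool := fun i => (s (i + 1)).getD i false
  have hxC : x ∈ C 0 := by
    refine hC x fun m k hk => ?_
    obtain ⟨j, h₁, h₂, hj⟩ := hs (m + 1) m (hsl (m + 1)) k hk
    obtain ⟨hjl, hj⟩ := List.getElem?_eq_some_iff.1 hj
    exact ⟨j, h₁, h₂, (mem_Cyl_iff_getElem.1 (hx (m + 1)) j hjl).trans hj⟩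
  obtain ⟨i, hi⟩ := hT x (hST hxC)
  obtain ⟨ρ, hρ⟩ := hne i _ (hs i)
  exact hi ρ (Cyl_subset_of_isPrefix hρ (hx (i + 1)))

theorem computable_initSeg {x : ℕ → Bool} (hx : Computable x) : Computable (initSeg x) := by
  refine (Computable.nat_rec .id (.const []) (Computable.list_concat.comp
    (Computable.snd.comp .snd) (hx.comp (Computable.fst.comp .snd))).to₂).of_eq fun n => ?_
  induction n with
  | zero => rfl
  | succ n ih =>
    rw [initSeg_succ, ← ih]
    rfl

/-- The sequence `x` with its beginning overwritten by `σ`. -/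
def graft (σ : List Bool) (x : ℕ → Bool) (i : ℕ) : Bool :=
  if h : i < σ.length then σ[i] else x i

theorem take_append_drop_initSeg (σ : List Bool) (x : ℕ → Bool) (n : ℕ) :
    (σ ++ (initSeg x n).drop σ.length).take n = initSeg (graft σ x) n := by
  refine List.ext_getElem (by simp; omega) fun i h₁ h₂ => ?_
  simp only [List.getElem_take, List.getElem_append, List.getElem_drop]
  simp only [initSeg, List.getElem_map, List.getElem_range, graft]
  split_ifs
  · rfl
  · congr 1
    omega

theorem EffMeagerIn.effMeager {A : Set ℕ} (hA : ¬ WeaklyMeagerEngulfing A)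
    (hA' : ¬ HyperimmuneDegree A) {S : Set (ℕ → Bool)} (hS : EffMeagerIn A S) : EffMeager S := by
  obtain ⟨C, ⟨W, hW, hC⟩, hN, hS⟩ := hS
  let d : ℕ → ℕ × List Bool := fun c => (Encodable.decode c).getD (0, [])
  have hd : Computable d := Computable.option_getD .decode (.const _)
  let h : ℕ × List Bool → ℕ × List Bool := fun p =>
    ((d p.1).1, ((d p.1).2 ++ p.2.drop (d p.1).2.length).take p.2.length)
  have hh : Computable h :=
    (Computable.fst.comp (hd.comp .fst)).pair (Primrec.list_take.to_comp.comp
      (Computable.list_length.comp .snd) (Computable.list_append.comp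
        (Computable.snd.comp (hd.comp .fst)) (Primrec.list_drop.to_comp.comp
          (Computable.list_length.comp (Computable.snd.comp (hd.comp .fst))) .snd)))
  have h_initSeg : ∀ c x n, h (c, initSeg x n) = ((d c).1, initSeg (graft (d c).2 x) n) := by
    intro c x n
    simp only [h, length_initSeg, take_append_drop_initSeg]
  let E : ℕ → Set (ℕ → Bool) := fun c => (⋃ σ ∈ {s | (c, s) ∈ h ⁻¹' W}, Cyl σ)ᶜ
  have hE : ∀ c, IsNowhereDense (E c) := by
    intro c
    refine isNowhereDense_compl_iff.2 fun ρ => ?_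
    obtain ⟨y, hy⟩ := nonempty_Cyl ρ
    have hNc := hN (d c).1
    rw [hC, isNowhereDense_compl_iff] at hNc
    obtain ⟨z, hz, τ, hτ, hzτ⟩ :=
      hNc (initSeg (graft (d c).2 y) (max ρ.length (d c).2.length))
    rw [mem_Cyl_initSeg] at hz
    let x : ℕ → Bool := fun i => if i < (d c).2.length then y i else z i
    have hx : graft (d c).2 x = z := by
      funext i
      by_cases hi : i < (d c).2.length
      · rw [hz i (lt_max_of_lt_right hi)]
        simp [graft, hi]
      · simp [graft, x, hi]
    refine ⟨x, fun i hi => ?_, initSeg x τ.length, ?_, mem_Cyl_initSeg_self _ _⟩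
    · rw [← hy i hi]
      by_cases hi' : i < (d c).2.length
      · simp [x, hi']
      · simp [x, hi', hz i (lt_max_of_lt_left hi), graft]
    · change h (c, initSeg x τ.length) ∈ W
      rw [h_initSeg, hx, mem_Cyl_iff.1 hzτ]
      exact hτ
  obtain ⟨x, hx, hxE⟩ : ∃ x : ℕ → Bool, Computable x ∧ x ∉ ⋃ c, E c := by
    by_contra! hcon
    exact hA ⟨_, ⟨E, ⟨_, hW.preimage hh, fun m => rfl⟩, hE, subset_rfl⟩, hcon⟩
  have hxW : ∀ c, ∃ n, h (c, initSeg x n) ∈ W := by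
    intro c
    have : x ∉ E c := fun hxc => hxE (Set.mem_iUnion.2 ⟨c, hxc⟩)
    simp only [E, Set.mem_compl_iff, not_not, Set.mem_iUnion] at this
    obtain ⟨ρ, hρ, hxρ⟩ := this
    refine ⟨ρ.length, ?_⟩
    rw [mem_Cyl_iff.1 hxρ]
    exact hρ
  obtain ⟨P, hP, hPW⟩ := hW.exists_stages
  have hseg := computable_initSeg hx
  obtain ⟨q, hq, hqP⟩ := exists_computable_bound hA'
    (P := fun l c => P (l.take l.length.unpair.1) (h (c, initSeg x l.length.unpair.2)))
    (hP.comp (Primrec.list_take.to_comp.comp (Computable.fst.comp (Computable.unpair.comp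
        (Computable.list_length.comp .fst))) .fst)
      (hh.comp (Computable.snd.pair (hseg.comp (Computable.snd.comp (Computable.unpair.comp
        (Computable.list_length.comp .fst)))))))
    fun c => by
      obtain ⟨n, hn⟩ := hxW c
      obtain ⟨k, hk⟩ := (hPW _).1 hn
      refine ⟨Nat.pair k n, ?_⟩
      simpa [take_initSeg _ (Nat.left_le_pair k n)] using hk
  refine effMeager_iff.2 ⟨fun i σ => σ ++ (initSeg x (q (Encodable.encode (i, σ)))).drop σ.length,
    ?_, fun i σ => List.prefix_append _ _, fun z hz => ?_⟩
  · exact Computable.list_append.comp .snd (Primrec.list_drop.to_comp.comp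
      (Computable.list_length.comp .snd) (hseg.comp (hq.comp Computable.encode)))
  · obtain ⟨i, hi⟩ := Set.mem_iUnion.1 (hS hz)
    refine ⟨i, fun σ hzσ => ?_⟩
    obtain ⟨k, hk, hkP⟩ := hqP (Encodable.encode (i, σ))
    rw [length_initSeg, take_initSeg _ (Nat.unpair_left_le k), h_initSeg,
      show d (Encodable.encode (i, σ)) = (i, σ) by simp only [d, Encodable.encodek]; rfl] at hkP
    have hz' := Cyl_subset_of_isPrefix (List.take_prefix (q (Encodable.encode (i, σ))) _) hzσ
    rw [take_append_drop_initSeg, mem_Cyl_initSeg] at hz'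
    rw [hC i] at hi
    exact hi (Set.mem_biUnion ((hPW _).2 ⟨_, hkP⟩) (mem_Cyl_initSeg.2 fun j hj =>
      hz' j (hj.trans_le ((Nat.unpair_right_le k).trans hk))))

/-- `A` is not low for weak 1-genericity iff `A` is weakly meager
engulfing or `A` is of hyperimmune degree. -/
theorem stmt15 (A : Set ℕ) :
    (∃ S, EffMeagerIn A S ∧ ∀ T, EffMeager T → ¬ S ⊆ T) ↔
      (WeaklyMeagerEngulfing A ∨ HyperimmuneDegree A) := by
  constructor
  · rintro ⟨S, hS, hST⟩
    by_contra! hA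
    exact hST S (hS.effMeager hA.1 hA.2) subset_rfl
  · rintro (hA | hA)
    · exact hA.exists_not_subset
    · exact hA.exists_not_subset

end CichonAnalog
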